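/- arXiv:2008.12119 — 2 statements merged into one kernel-verified Lean document; each statement's English description precedes it below -/
import Mathlib

section
/- For an elliptic curve E over a finite field F_q with N rational points, |N - (q+1)| ≤ 2√q. -/
section

open Polynomial

namespace WeierstrassCurve.Affine.Point

variable {L : Type*} [Field L] [DecidableEq L] {W : WeierstrassCurve.Affine L}

lemma addSubMap_sym2x_self [W.IsElliptic] (P : W.Point) : ∃ c : L, c ≠ 0 ∧
    ∀ i, (addSubMap W i).eval (P.sym2x P) = c * (P + P).sym2x 0 i := by
  match P with
  | 0 => exact ⟨1, one_ne_zero, fun i ↦ by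
      rw [add_zero]
      fin_cases i <;> simp [addSubMap]⟩
  | some x y h =>
    by_cases hy : y = W.negY x y
    · rw [add_self_of_Y_eq hy]
      have hne := addSubMap_ne_zero W (sym2x_ne_zero (some x y h) (some x y h))
      have h1 : (addSubMap W 1).eval ((some x y h).sym2x (some x y h)) = 0 := by
        have := (W.equation_iff x y).mp h.1
        simp only [negY] at hy
        simp [addSubMap, b₂, b₄, b₆]
        grind
      have h2 : (addSubMap W 2).eval ((some x y h).sym2x (some x y h)) = 0 := by
        simp [addSubMap]; ring
      refine ⟨(addSubMap W 0).eval ((some x y h).sym2x (some x y h)), fun h0 ↦ hne ?_, fun i ↦ ?_⟩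
      · funext i
        fin_cases i
        exacts [h0, h1, h2]
      · fin_cases i
        exacts [by simp, by simpa using h1, by simpa using h2]
    · rw [add_self_of_Y_ne hy, sym2x_some_zero, sym2x_some_some]
      have hd : y - W.negY x y ≠ 0 := sub_ne_zero.mpr hy
      have he := (W.equation_iff x y).mp h.1
      refine ⟨(y - W.negY x y) ^ 2, pow_ne_zero 2 hd, fun i ↦ ?_⟩
      rw [slope_of_Y_ne rfl hy]
      generalize hD : y - W.negY x y = D at hd
      simp only [negY] at hD
      fin_cases i
      · simp [addSubMap, b₂, b₄, b₆, b₈]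
        field_simp
        subst hD
        grind
      · simp [addSubMap, b₂, b₄, b₆, b₈]
        subst hD
        grind
      · simp [addSubMap, b₂, b₄, b₆, b₈]; ring

lemma exists_addSubMap_sym2x [W.IsElliptic] (P Q : W.Point) : ∃ c : L, c ≠ 0 ∧
    ∀ i, (addSubMap W i).eval (P.sym2x Q) = c * (P + Q).sym2x (P - Q) i := by
  match P, Q with
  | 0, Q =>
    refine ⟨1, one_ne_zero, fun i ↦ ?_⟩
    rw [zero_add, zero_sub, sym2x_neg_right]
    match Q with
    | 0 => fin_cases i <;> simp [addSubMap]
    | some .. => fin_cases i <;> simp [addSubMap] <;> ring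
  | P, 0 =>
    refine ⟨1, one_ne_zero, fun i ↦ ?_⟩
    rw [add_zero, sub_zero]
    match P with
    | 0 => fin_cases i <;> simp [addSubMap]
    | some .. => fin_cases i <;> simp [addSubMap] <;> ring
  | some x₁ y₁ h₁, some x₂ y₂ h₂ =>
    by_cases hx : x₁ = x₂
    · rcases X_eq_iff.mp hx with h | h
      · rw [h, sub_self]
        exact addSubMap_sym2x_self _
      · obtain ⟨c, hc, H⟩ := addSubMap_sym2x_self (some x₂ y₂ h₂)
        refine ⟨c, hc, fun i ↦ ?_⟩
        rw [h, sym2x_neg_left, H, neg_add_cancel, ← sym2x_neg_left, sym2x_comm]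
        congr 2
        abel
    · rw [sub_eq_add_neg, neg_some, add_of_X_ne hx, add_of_X_ne hx, sym2x_some_some,
        sym2x_some_some, slope_of_X_ne hx, slope_of_X_ne hx]
      have hd : x₁ - x₂ ≠ 0 := sub_ne_zero.mpr hx
      have he₁ := (W.equation_iff x₁ y₁).mp h₁.1
      have he₂ := (W.equation_iff x₂ y₂).mp h₂.1
      refine ⟨(x₁ - x₂) ^ 2, pow_ne_zero 2 hd, fun i ↦ ?_⟩
      generalize hD : x₁ - x₂ = D at hd
      fin_cases i
      · simp [addSubMap, b₂, b₄, b₆, b₈]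
        field_simp
        subst hD
        grind
      · simp [addSubMap, b₂, b₄, b₆, b₈]
        field_simp
        subst hD
        grind
      · simp [addSubMap, b₂, b₄, b₆, b₈, ← hD]; ring

end WeierstrassCurve.Affine.Point

section Parallelogram

variable {A : Type*} [AddCommGroup A] {h : A → ℤ}

/-- The parallelogram law determines a function along an arithmetic progression. -/
lemma map_add_zsmul_of_parallelogram
    (hh : ∀ P Q, h (P + Q) + h (P - Q) = 2 * h P + 2 * h Q) (P Q : A) (n : ℤ) :
    h (P + n • Q) = h P + n * (h (P + Q) - h P - h Q) + n ^ 2 * h Q := by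
  have key (n : ℤ) : h (P + (n + 1) • Q) + h (P + (n - 1) • Q) =
      2 * h (P + n • Q) + 2 * h Q := by
    rw [← hh]
    congr 2 <;> module
  have pair (n : ℤ) :
      h (P + n • Q) = h P + n * (h (P + Q) - h P - h Q) + n ^ 2 * h Q ∧
      h (P + (n + 1) • Q) = h P + (n + 1) * (h (P + Q) - h P - h Q) + (n + 1) ^ 2 * h Q := by
    induction n with
    | zero => exact ⟨by simp, by simp; ring⟩
    | succ k ih =>
      have h3 := key (k + 1)
      rw [show (k : ℤ) + 1 - 1 = k by ring] at h3
      exact ⟨ih.2, by linear_combination h3 + 2 * ih.2 - ih.1⟩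
    | pred k ih =>
      have h3 := key (-k)
      rw [show -(k : ℤ) - 1 + 1 = -k by ring]
      exact ⟨by linear_combination h3 + 2 * ih.1 - ih.2, ih.1⟩
  exact (pair n).1

/-- The Cauchy–Schwarz inequality for a nonnegative function satisfying the parallelogram law,
where one of the two arguments has value `1`. -/
lemma sq_le_four_mul_of_parallelogram
    (hh : ∀ P Q, h (P + Q) + h (P - Q) = 2 * h P + 2 * h Q) (h0 : ∀ P, 0 ≤ h P) (P Q : A)
    (hQ : h Q = 1) : (h (P + Q) - h P - h Q) ^ 2 ≤ 4 * h P := by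
  set c := h (P + Q) - h P - h Q with hc
  have hz : h 0 = 0 := by have := hh 0 0; simp at this; lia
  have h2 : h (P + P) = 4 * h P := by have := hh P P; simp [hz] at this; lia
  have h3 := map_add_zsmul_of_parallelogram hh Q P 2
  rw [two_smul, add_comm Q (P + P), add_comm Q P] at h3
  have h4 := map_add_zsmul_of_parallelogram hh (P + P) Q (-c)
  have h5 := h0 (P + P + -c • Q)
  rw [h4, h3, h2, hQ] at h5
  have hs : h (P + Q) = c + h P + 1 := by lia
  rw [hs] at h5
  linarith

end Parallelogram

/-- The maximum of the degrees of the entries of `u` is `n`. -/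
def HasMaxDegree {F ι : Type*} [Semiring F] (u : ι → F[X]) (n : ℕ) : Prop :=
  (∀ i, (u i).natDegree ≤ n) ∧ (fun i ↦ (u i).coeff n) ≠ 0

/-- The entries of `u` have no common zero modulo any prime ideal. -/
def IsPrimitiveVec {R ι : Type*} [CommRing R] (u : ι → R) : Prop :=
  ∀ p : Ideal R, p.IsPrime → (fun i ↦ Ideal.Quotient.mk p (u i)) ≠ 0

lemma IsPrimitiveVec.span_eq_top {R ι : Type*} [CommRing R] {u : ι → R} (hu : IsPrimitiveVec u) :
    Ideal.span (Set.range u) = ⊤ := by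
  by_contra h
  obtain ⟨m, hm, hle⟩ := Ideal.exists_le_maximal _ h
  refine hu m hm.isPrime (funext fun i ↦ Ideal.Quotient.eq_zero_iff_mem.mpr ?_)
  exact hle (Ideal.subset_span ⟨i, rfl⟩)

lemma IsPrimitiveVec.maxDegree_unique {F L ι : Type*} [Field F] [Field L] [Finite ι]
    [Algebra F[X] L] [FaithfulSMul F[X] L] {u v : ι → F[X]} (hu : IsPrimitiveVec u)
    (hv : IsPrimitiveVec v) {m n : ℕ} (hm : HasMaxDegree u m) (hn : HasMaxDegree v n) {c : L}
    (hc : c ≠ 0) (h : ∀ i, algebraMap F[X] L (u i) = c * algebraMap F[X] L (v i)) : m = n := by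
  cases nonempty_fintype ι
  have hinj := FaithfulSMul.algebraMap_injective F[X] L
  obtain ⟨r, hr⟩ := (Ideal.mem_span_range_iff_exists_fun (R := F[X])).mp
    (hv.span_eq_top ▸ Submodule.mem_top (x := 1))
  obtain ⟨s, hs⟩ := (Ideal.mem_span_range_iff_exists_fun (R := F[X])).mp
    (hu.span_eq_top ▸ Submodule.mem_top (x := 1))
  obtain ⟨k, rfl⟩ : ∃ k, algebraMap F[X] L k = c := by
    refine ⟨∑ i, r i * u i, ?_⟩
    simp_rw [map_sum, map_mul, h]
    calc _ = c * algebraMap F[X] L (∑ i, r i * v i) := by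
            rw [map_sum, Finset.mul_sum]
            exact Finset.sum_congr rfl fun i _ ↦ by rw [map_mul]; ring
      _ = c := by rw [hr, map_one, mul_one]
  have huv (i) : u i = k * v i := hinj (by rw [h, map_mul])
  have hk : IsUnit k := .of_mul_eq_one (∑ i, s i * v i) (by
    rw [← hs, Finset.mul_sum]
    exact Finset.sum_congr rfl fun i _ ↦ by rw [huv]; ring)
  obtain ⟨a, ha, rfl⟩ := Polynomial.isUnit_iff.mp hk
  obtain ⟨i, hi⟩ := Function.ne_iff.mp hm.2
  obtain ⟨j, hj⟩ := Function.ne_iff.mp hn.2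
  apply le_antisymm
  · refine (le_natDegree_of_ne_zero hi).trans ?_
    rw [huv, natDegree_C_mul_of_isUnit ha]
    exact hn.1 i
  · refine (le_natDegree_of_ne_zero hj).trans ?_
    rw [← natDegree_C_mul_of_isUnit ha, ← huv]
    exact hm.1 j

/-- The symmetric product of two vectors of length two. -/
def symMul {R : Type*} [CommRing R] (u v : Fin 2 → R) : Fin 3 → R :=
  ![u 0 * v 0, u 0 * v 1 + u 1 * v 0, u 1 * v 1]

lemma symMul_ne_zero {R : Type*} [CommRing R] [IsDomain R] {u v : Fin 2 → R} (hu : u ≠ 0)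
    (hv : v ≠ 0) : symMul u v ≠ 0 := by
  intro h
  have h0 := congrFun h 0
  have h1 := congrFun h 1
  have h2 := congrFun h 2
  simp [symMul] at h0 h1 h2
  have hu' : u 0 ≠ 0 ∨ u 1 ≠ 0 := by
    by_contra! H; exact hu (by ext i; fin_cases i; exacts [H.1, H.2])
  have hv' : v 0 ≠ 0 ∨ v 1 ≠ 0 := by
    by_contra! H; exact hv (by ext i; fin_cases i; exacts [H.1, H.2])
  rcases h0 with h0 | h0 <;> rcases h2 with h2 | h2 <;> simp_all

lemma map_symMul {R S : Type*} [CommRing R] [CommRing S] (f : R →+* S) (u v : Fin 2 → R) (i) :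
    f (symMul u v i) = symMul (fun i ↦ f (u i)) (fun i ↦ f (v i)) i := by
  fin_cases i <;> simp [symMul]

lemma symMul_smul {R : Type*} [CommRing R] (a b : R) (u v : Fin 2 → R) (i) :
    symMul (fun i ↦ a * u i) (fun i ↦ b * v i) i = a * b * symMul u v i := by
  fin_cases i <;> simp [symMul] <;> ring

lemma WeierstrassCurve.Affine.Point.sym2x_eq_symMul {R : Type*} [CommRing R]
    {W : WeierstrassCurve.Affine R} (P Q : W.Point) : P.sym2x Q = symMul P.xRep Q.xRep := rfl

lemma IsPrimitiveVec.symMul {R : Type*} [CommRing R] {u v : Fin 2 → R} (hu : IsPrimitiveVec u)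
    (hv : IsPrimitiveVec v) : IsPrimitiveVec (symMul u v) := by
  intro p hp
  simp_rw [map_symMul]
  exact symMul_ne_zero (hu p hp) (hv p hp)

lemma HasMaxDegree.symMul {F : Type*} [Field F] {u v : Fin 2 → F[X]} {m n : ℕ}
    (hu : HasMaxDegree u m) (hv : HasMaxDegree v n) : HasMaxDegree (symMul u v) (m + n) := by
  have hd (i j) : (u i * v j).natDegree ≤ m + n := natDegree_mul_le_of_le (hu.1 i) (hv.1 j)
  refine ⟨fun i ↦ ?_, ?_⟩
  · fin_cases i
    exacts [hd 0 0, natDegree_add_le_of_degree_le (hd 0 1) (hd 1 0), hd 1 1]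
  · convert! symMul_ne_zero hu.2 hv.2 using 1
    funext i
    fin_cases i <;> simp [_root_.symMul, coeff_mul_add_eq_of_natDegree_le (hu.1 _) (hv.1 _)]

namespace WeierstrassCurve

/-- The values of the polynomials in `addSubMap`, as a function on vectors. -/
noncomputable def addSubVec {R : Type*} [CommRing R] (W : WeierstrassCurve R) (x : Fin 3 → R) :
    Fin 3 → R :=
  fun i ↦ (addSubMap W i).eval x

lemma addSubVec_apply {R : Type*} [CommRing R] (W : WeierstrassCurve R) (x : Fin 3 → R) :
    addSubVec W x = ![x 0 ^ 2 - W.b₄ * x 0 * x 2 - W.b₆ * x 1 * x 2 - W.b₈ * x 2 ^ 2,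
      2 * x 1 * x 0 + W.b₂ * x 0 * x 2 + W.b₄ * x 1 * x 2 + W.b₆ * x 2 ^ 2,
      x 1 ^ 2 - 4 * x 0 * x 2] := by
  funext i
  fin_cases i <;> simp [addSubVec, addSubMap]

lemma map_addSubVec {R S : Type*} [CommRing R] [CommRing S] (W : WeierstrassCurve R)
    (f : R →+* S) (x : Fin 3 → R) (i) :
    f (addSubVec W x i) = addSubVec (W.map f) (fun i ↦ f (x i)) i := by
  have h2 : f 2 = 2 := map_ofNat f 2
  have h4 : f 4 = 4 := map_ofNat f 4
  rw [addSubVec_apply, addSubVec_apply]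
  fin_cases i <;> simp [h2, h4]

lemma addSubVec_smul {R : Type*} [CommRing R] (W : WeierstrassCurve R) (c : R) (x : Fin 3 → R)
    (i) : addSubVec W (fun i ↦ c * x i) i = c ^ 2 * addSubVec W x i := by
  rw [addSubVec_apply, addSubVec_apply]
  fin_cases i <;> simp <;> ring

lemma _root_.IsPrimitiveVec.addSubVec {R : Type*} [CommRing R] (W : WeierstrassCurve R)
    [W.IsElliptic] {u : Fin 3 → R} (hu : IsPrimitiveVec u) : IsPrimitiveVec (addSubVec W u) := by
  intro p hp
  simp_rw [map_addSubVec]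
  exact addSubMap_ne_zero _ (hu p hp)

lemma _root_.HasMaxDegree.addSubVec {F : Type*} [Field F] (W : WeierstrassCurve F)
    [W.IsElliptic] {u : Fin 3 → F[X]} {n : ℕ} (hu : HasMaxDegree u n) :
    HasMaxDegree (addSubVec (W.map C) u) (2 * n) := by
  have hd (i j) : (u i * u j).natDegree ≤ 2 * n :=
    (natDegree_mul_le_of_le (hu.1 i) (hu.1 j)).trans_eq (two_mul n).symm
  have hc (a i j) : (C a * (u i * u j)).natDegree ≤ 2 * n := (natDegree_C_mul_le _ _).trans (hd i j)
  have hco (i j) : (u i * u j).coeff (2 * n) = (u i).coeff n * (u j).coeff n := by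
    rw [two_mul, coeff_mul_add_eq_of_natDegree_le (hu.1 _) (hu.1 _)]
  have hexp : WeierstrassCurve.addSubVec (W.map C) u =
      ![u 0 * u 0 - C W.b₄ * (u 0 * u 2) - C W.b₆ * (u 1 * u 2) - C W.b₈ * (u 2 * u 2),
      C 2 * (u 1 * u 0) + C W.b₂ * (u 0 * u 2) + C W.b₄ * (u 1 * u 2) + C W.b₆ * (u 2 * u 2),
      u 1 * u 1 - C 4 * (u 0 * u 2)] := by
    have h2 : C (2 : F) = 2 := map_ofNat C 2
    have h4 : C (4 : F) = 4 := map_ofNat C 4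
    rw [addSubVec_apply]
    funext i
    fin_cases i <;> simp [h2, h4] <;> ring
  rw [hexp]
  refine ⟨fun i ↦ ?_, ?_⟩
  · fin_cases i
    · exact natDegree_sub_le_of_le (natDegree_sub_le_of_le (natDegree_sub_le_of_le (hd _ _)
        (hc _ _ _)) (hc _ _ _)) (hc _ _ _) |>.trans (by simp)
    · exact natDegree_add_le_of_degree_le (natDegree_add_le_of_degree_le
        (natDegree_add_le_of_degree_le (hc _ _ _) (hc _ _ _)) (hc _ _ _)) (hc _ _ _)
    · exact natDegree_sub_le_of_le (hd _ _) (hc _ _ _) |>.trans (by simp)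
  · convert! addSubMap_ne_zero W hu.2 using 1
    change _ = WeierstrassCurve.addSubVec W _
    rw [addSubVec_apply]
    funext i
    fin_cases i <;> simp only [coeff_sub, coeff_add, coeff_C_mul, hco, Fin.zero_eta, Fin.mk_one,
      Fin.reduceFinMk, Matrix.cons_val] <;> ring

end WeierstrassCurve

namespace WeierstrassCurve.Affine.Point

variable {F L : Type*} [Field F] [Field L] [Algebra F L] [Algebra F[X] L] {W : WeierstrassCurve F}

/-- The image of `P` under the `x`-coordinate map to the projective line is represented by a
primitive vector of polynomials of degree `n`, so that `n` is the naive height of `P`. -/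
def HasHeight (P : (W⁄L).Point) (n : ℕ) : Prop :=
  ∃ u : Fin 2 → F[X], IsPrimitiveVec u ∧ HasMaxDegree u n ∧
    ∃ c : L, c ≠ 0 ∧ ∀ i, algebraMap F[X] L (u i) = c * P.xRep i

lemma hasHeight_zero : (0 : (W⁄L).Point).HasHeight (F := F) 0 := by
  refine ⟨![1, 0], fun p hp h0 ↦ ?_, ⟨fun i ↦ ?_, fun h0 ↦ ?_⟩, 1, one_ne_zero, fun i ↦ ?_⟩
  · exact hp.ne_top ((Ideal.eq_top_iff_one p).mpr
      (Ideal.Quotient.eq_zero_iff_mem.mp (congrFun h0 0)))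
  · fin_cases i <;> simp
  · simpa using congrFun h0 0
  · fin_cases i <;> simp

variable [FaithfulSMul F[X] L]

lemma HasHeight.unique {P : (W⁄L).Point} {m n : ℕ} (hm : P.HasHeight (F := F) m)
    (hn : P.HasHeight (F := F) n) : m = n := by
  obtain ⟨u, hu, hum, c, hc, huc⟩ := hm
  obtain ⟨v, hv, hvn, d, hd, hvd⟩ := hn
  refine hu.maxDegree_unique hv hum hvn (mul_ne_zero hc (inv_ne_zero hd)) fun i ↦ ?_
  rw [huc, hvd]
  field_simp

lemma hasHeight_some {x y : L} (h : (W⁄L).Nonsingular x y) {a b : F[X]} {n : ℕ}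
    (hab : IsCoprime a b) (hb : b ≠ 0) (hx : algebraMap F[X] L a = algebraMap F[X] L b * x)
    (hn : max a.natDegree b.natDegree = n) : (some x y h).HasHeight (F := F) n := by
  subst hn
  refine ⟨![a, b], fun p hp h0 ↦ ?_, ⟨fun i ↦ ?_, fun h0 ↦ ?_⟩, algebraMap F[X] L b,
    by simpa using hb, fun i ↦ ?_⟩
  · obtain ⟨r, s, hrs⟩ := hab
    have h1 : a ∈ p := Ideal.Quotient.eq_zero_iff_mem.mp (congrFun h0 0)
    have h2 : b ∈ p := Ideal.Quotient.eq_zero_iff_mem.mp (congrFun h0 1)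
    exact hp.ne_top ((Ideal.eq_top_iff_one p).mpr
      (hrs ▸ p.add_mem (p.mul_mem_left r h1) (p.mul_mem_left s h2)))
  · fin_cases i
    exacts [le_max_left _ _, le_max_right _ _]
  · have h1 : a.coeff (max a.natDegree b.natDegree) = 0 := congrFun h0 0
    have h2 : b.coeff (max a.natDegree b.natDegree) = 0 := congrFun h0 1
    rcases le_total a.natDegree b.natDegree with h | h
    · rw [max_eq_right h] at h2
      exact hb (leadingCoeff_eq_zero.mp h2)
    · rw [max_eq_left h] at h1 h2
      have ha := leadingCoeff_eq_zero.mp h1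
      subst ha
      rw [natDegree_zero, Nat.le_zero] at h
      rw [natDegree_zero, ← h] at h2
      exact hb (leadingCoeff_eq_zero.mp h2)
  · fin_cases i <;> simp [hx]

/-- A point whose `x`-coordinate is a rational function has a height. -/
lemma exists_hasHeight_some {x y : L} (h : (W⁄L).Nonsingular x y) {a b : F[X]} (hb : b ≠ 0)
    (hx : algebraMap F[X] L a = algebraMap F[X] L b * x) :
    ∃ n, (some x y h).HasHeight (F := F) n := by
  classical
  obtain ⟨a', ha⟩ := EuclideanDomain.gcd_dvd_left a b
  obtain ⟨b', hb'⟩ := EuclideanDomain.gcd_dvd_right a b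
  have hg : EuclideanDomain.gcd a b ≠ 0 := fun h ↦ hb (EuclideanDomain.gcd_eq_zero_iff.mp h).2
  have hb0 : b' ≠ 0 := by rintro rfl; exact hb (by simpa using hb')
  refine ⟨_, hasHeight_some h (a := a') (b := b') ?_ hb0 ?_ rfl⟩
  · refine ⟨EuclideanDomain.gcdA a b, EuclideanDomain.gcdB a b, mul_left_cancel₀ hg ?_⟩
    have := EuclideanDomain.gcd_eq_gcd_ab a b
    calc _ = (EuclideanDomain.gcd a b * a') * EuclideanDomain.gcdA a b +
          (EuclideanDomain.gcd a b * b') * EuclideanDomain.gcdB a b := by ring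
      _ = _ := by rw [← ha, ← hb', ← this, mul_one]
  · have hg' : algebraMap F[X] L (EuclideanDomain.gcd a b) ≠ 0 := by simpa using hg
    refine mul_left_cancel₀ hg' ?_
    rw [← mul_assoc, ← map_mul, ← map_mul, ← ha, ← hb', hx]

lemma HasHeight.parallelogram [IsScalarTower F F[X] L] [DecidableEq L] [W.IsElliptic]
    {P Q : (W⁄L).Point} {m n k l : ℕ}
    (hP : P.HasHeight (F := F) m) (hQ : Q.HasHeight (F := F) n)
    (hadd : (P + Q).HasHeight (F := F) k) (hsub : (P - Q).HasHeight (F := F) l) :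
    k + l = 2 * (m + n) := by
  obtain ⟨u, hu, hud, c, hc, huc⟩ := hP
  obtain ⟨v, hv, hvd, d, hd, hvc⟩ := hQ
  obtain ⟨s, hs, hsd, e, he, hsc⟩ := hadd
  obtain ⟨t, ht, htd, f, hf, htc⟩ := hsub
  have : (W⁄L).IsElliptic := inferInstanceAs (W.map (algebraMap F L)).IsElliptic
  obtain ⟨g, hg, hgc⟩ := exists_addSubMap_sym2x P Q
  have hW : (W.map C).map (algebraMap F[X] L) = W⁄L := by
    rw [WeierstrassCurve.map_map, ← Polynomial.algebraMap_eq, ← IsScalarTower.algebraMap_eq]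
    rfl
  refine (hs.symMul ht).maxDegree_unique ((hu.symMul hv).addSubVec (W.map C))
    (hsd.symMul htd) ((hud.symMul hvd).addSubVec W)
    (c := e * f * ((c * d) ^ 2 * g)⁻¹) ?_ fun i ↦ ?_
  · exact mul_ne_zero (mul_ne_zero he hf)
      (inv_ne_zero (mul_ne_zero (pow_ne_zero 2 (mul_ne_zero hc hd)) hg))
  · simp_rw [map_addSubVec, map_symMul, huc, hvc, hsc, htc]
    rw [funext (symMul_smul c d P.xRep Q.xRep), symMul_smul, addSubVec_smul, hW]
    rw [← sym2x_eq_symMul, ← sym2x_eq_symMul]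
    change _ = _ * (_ * (addSubMap (W⁄L) i).eval _)
    rw [hgc]
    field_simp

end WeierstrassCurve.Affine.Point

namespace WeierstrassCurve.Affine

open scoped Polynomial.Bivariate

variable {F : Type*} [Field F] (W : WeierstrassCurve.Affine F)

lemma CoordinateRing.mk_Y_sq : mk W Y ^ 2 =
    mk W (C (X ^ 3 + C W.a₂ * X ^ 2 + C W.a₄ * X + C W.a₆)) -
    mk W (C (C W.a₁ * X + C W.a₃)) * mk W Y := by
  have h (p : F[X][Y]) (hp : p = W.polynomial) : mk W p = 0 := by
    rw [hp]
    exact AdjoinRoot.mk_self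
  have := h _ (WeierstrassCurve.Affine.polynomial.eq_def W).symm
  rw [map_sub, map_add, map_mul, map_pow] at this
  linear_combination this

/-- The hyperelliptic involution of the coordinate ring, sending `Y` to `-Y - a₁X - a₃`. -/
noncomputable def CoordinateRing.conj : W.CoordinateRing →ₐ[F[X]] W.CoordinateRing :=
  AdjoinRoot.liftAlgHom W.polynomial (Algebra.ofId F[X] W.CoordinateRing)
    (CoordinateRing.mk W W.negPolynomial) <| by
      have h (p : F[X][Y]) (hp : p = W.polynomial) (f : F[X] →+* W.CoordinateRing)
          (hf : ∀ p, f p = mk W (C p)) :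
          eval₂ f (CoordinateRing.mk W W.negPolynomial) p = 0 := by
        rw [hp.trans (WeierstrassCurve.Affine.polynomial.eq_def W), eval₂_sub,
          eval₂_add, eval₂_mul, eval₂_pow, eval₂_C, eval₂_C, eval₂_X, hf, hf, negPolynomial, map_sub, map_neg]
        linear_combination mk_Y_sq W
      exact h _ rfl _ fun _ ↦ rfl

lemma CoordinateRing.conj_mk_Y : conj W (mk W Y) = mk W W.negPolynomial :=
  AdjoinRoot.liftAlgHom_root ..

lemma CoordinateRing.conj_conj (z : W.CoordinateRing) : conj W (conj W z) = z := by
  have h : (conj W).comp (conj W) = AlgHom.id F[X] _ := by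
    refine AdjoinRoot.algHom_ext ?_
    change conj W (conj W (mk W Y)) = mk W Y
    have hC (p : F[X]) : conj W (mk W (C p)) = mk W (C p) := (conj W).commutes p
    rw [conj_mk_Y, negPolynomial, map_sub, map_sub, hC, map_neg, map_neg, conj_mk_Y, negPolynomial,
      map_sub, map_neg]
    ring
  exact DFunLike.congr_fun h z

namespace FunctionField

/-- The `x`-coordinate function. -/
noncomputable def x : W.FunctionField := algebraMap F[X] W.FunctionField X

/-- The `y`-coordinate function. -/
noncomputable def y : W.FunctionField :=
  algebraMap W.CoordinateRing W.FunctionField (CoordinateRing.mk W Y)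

lemma algebraMap_comp_conj_injective : Function.Injective
    ((IsScalarTower.toAlgHom F[X] W.CoordinateRing W.FunctionField).comp
      (CoordinateRing.conj W)) :=
  (FaithfulSMul.algebraMap_injective W.CoordinateRing W.FunctionField).comp
    (Function.LeftInverse.injective (CoordinateRing.conj_conj W))

/-- The hyperelliptic involution of the function field. -/
noncomputable def conj : W.FunctionField →ₐ[F[X]] W.FunctionField :=
  IsFractionRing.liftAlgHom (algebraMap_comp_conj_injective W)

variable {W}

lemma algebraMap_coordinateRing_C (p : F[X]) :
    algebraMap W.CoordinateRing W.FunctionField (CoordinateRing.mk W (C p)) =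
      algebraMap F[X] W.FunctionField p :=
  (IsScalarTower.algebraMap_apply F[X] W.CoordinateRing W.FunctionField p).symm

lemma algebraMap_C (a : F) :
    algebraMap F[X] W.FunctionField (C a) = algebraMap F W.FunctionField a :=
  (IsScalarTower.algebraMap_apply F F[X] W.FunctionField a).symm

lemma conj_algebraMap (z : W.CoordinateRing) :
    conj W (algebraMap W.CoordinateRing W.FunctionField z) =
      algebraMap W.CoordinateRing W.FunctionField (CoordinateRing.conj W z) :=
  IsFractionRing.lift_algebraMap (algebraMap_comp_conj_injective W) z

lemma conj_y : conj W (y W) =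
    -y W - algebraMap F[X] W.FunctionField (C W.a₁ * X + C W.a₃) := by
  rw [y, conj_algebraMap, CoordinateRing.conj_mk_Y, negPolynomial, map_sub, map_neg, map_sub,
    map_neg, algebraMap_coordinateRing_C]

lemma y_sq : y W ^ 2 = algebraMap F[X] W.FunctionField
      (X ^ 3 + C W.a₂ * X ^ 2 + C W.a₄ * X + C W.a₆) -
    algebraMap F[X] W.FunctionField (C W.a₁ * X + C W.a₃) * y W := by
  have h := congrArg (algebraMap W.CoordinateRing W.FunctionField) (CoordinateRing.mk_Y_sq W)
  rwa [map_pow, map_sub, map_mul, algebraMap_coordinateRing_C, algebraMap_coordinateRing_C] at h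

lemma equation : (W⁄W.FunctionField).Equation (x W) (y W) := by
  rw [equation_iff']
  have := y_sq (W := W)
  simp only [map_add, map_mul, map_pow, algebraMap_C] at this
  change _ + algebraMap F _ _ * _ * _ + algebraMap F _ _ * _ -
    (_ + algebraMap F _ _ * _ + algebraMap F _ _ * _ + algebraMap F _ _) = 0
  rw [x]
  linear_combination this

lemma eq_zero_of_add_mul_y {p q : F[X]} (h : algebraMap F[X] W.FunctionField p +
    algebraMap F[X] W.FunctionField q * y W = 0) : p = 0 ∧ q = 0 := by
  refine CoordinateRing.smul_basis_eq_zero (W' := W)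
    (FaithfulSMul.algebraMap_injective W.CoordinateRing W.FunctionField ?_)
  rw [map_add, CoordinateRing.smul, CoordinateRing.smul, map_mul, map_mul,
    algebraMap_coordinateRing_C, algebraMap_coordinateRing_C, _root_.map_zero, map_one, mul_one]
  exact h

lemma exists_eq_add_mul_y (z : W.CoordinateRing) : ∃ p q : F[X],
    algebraMap W.CoordinateRing W.FunctionField z =
      algebraMap F[X] W.FunctionField p + algebraMap F[X] W.FunctionField q * y W := by
  obtain ⟨p, q, rfl⟩ := CoordinateRing.exists_smul_basis_eq z
  refine ⟨p, q, ?_⟩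
  rw [map_add, CoordinateRing.smul, CoordinateRing.smul, map_mul, map_mul,
    algebraMap_coordinateRing_C, algebraMap_coordinateRing_C, map_one, mul_one]
  rfl

lemma mul_conj (p q : F[X]) :
    (algebraMap F[X] W.FunctionField p + algebraMap F[X] W.FunctionField q * y W) *
      conj W (algebraMap F[X] W.FunctionField p + algebraMap F[X] W.FunctionField q * y W) =
    algebraMap F[X] W.FunctionField (p ^ 2 - p * q * (C W.a₁ * X + C W.a₃) -
      q ^ 2 * (X ^ 3 + C W.a₂ * X ^ 2 + C W.a₄ * X + C W.a₆)) := by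
  have h := y_sq (W := W)
  rw [map_add, map_mul, AlgHom.commutes, AlgHom.commutes, conj_y]
  rw [map_sub, map_sub, map_mul _ (q ^ 2), map_mul _ (p * q), map_mul _ p q, map_pow, map_pow]
  linear_combination -algebraMap F[X] W.FunctionField q ^ 2 * h

/-- An element of the function field fixed by the hyperelliptic involution is a rational function
of the `x`-coordinate. -/
lemma exists_of_conj_eq [W.IsElliptic] {z : W.FunctionField} (hz : conj W z = z) : ∃ a b : F[X],
    b ≠ 0 ∧ algebraMap F[X] W.FunctionField a = algebraMap F[X] W.FunctionField b * z := by
  have hinj := FaithfulSMul.algebraMap_injective F[X] W.FunctionField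
  obtain ⟨r, s, hs, rfl⟩ := IsFractionRing.div_surjective (A := W.CoordinateRing) z
  obtain ⟨p, q, hpq⟩ := exists_eq_add_mul_y s
  have hs0 : algebraMap W.CoordinateRing W.FunctionField s ≠ 0 := by
    simpa using nonZeroDivisors.ne_zero hs
  set b := p ^ 2 - p * q * (C W.a₁ * X + C W.a₃) -
      q ^ 2 * (X ^ 3 + C W.a₂ * X ^ 2 + C W.a₄ * X + C W.a₆) with hb
  have hmul := mul_conj (W := W) p q
  rw [← hpq, ← hb] at hmul
  have hs1 : conj W (algebraMap W.CoordinateRing W.FunctionField s) ≠ 0 := by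
    simpa using nonZeroDivisors.ne_zero hs
  have hb0 : b ≠ 0 := by
    intro h0
    rw [h0, _root_.map_zero] at hmul
    exact mul_ne_zero hs0 hs1 hmul
  obtain ⟨t, ht⟩ : ∃ t : W.CoordinateRing, algebraMap F[X] W.FunctionField b *
      (algebraMap W.CoordinateRing W.FunctionField r /
        algebraMap W.CoordinateRing W.FunctionField s) =
      algebraMap W.CoordinateRing W.FunctionField t := by
    refine ⟨r * CoordinateRing.conj W s, ?_⟩
    rw [map_mul, ← hmul]
    rw [conj_algebraMap]
    field_simp
  obtain ⟨a, d, had⟩ := exists_eq_add_mul_y t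
  refine ⟨a, b, hb0, ?_⟩
  have hconj := congrArg (conj W) ht
  rw [map_mul, hz, AlgHom.commutes, ht, had, map_add, map_mul, AlgHom.commutes, AlgHom.commutes,
    conj_y] at hconj
  suffices hd : d = 0 by
    rw [ht, had, hd, _root_.map_zero, zero_mul, add_zero]
  by_contra hd
  have h2 : algebraMap F[X] W.FunctionField (d * (C W.a₁ * X + C W.a₃)) +
      algebraMap F[X] W.FunctionField (d * 2) * y W = 0 := by
    rw [map_mul, map_mul, map_ofNat]
    linear_combination hconj
  obtain ⟨h3, h4⟩ := eq_zero_of_add_mul_y h2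
  replace h3 := (mul_eq_zero.mp h3).resolve_left hd
  replace h4 := (mul_eq_zero.mp h4).resolve_left hd
  have ha1 : W.a₁ = 0 := by simpa using congrArg (coeff · 1) h3
  have ha3 : W.a₃ = 0 := by simpa using congrArg (coeff · 0) h3
  have hF2 : (2 : F) = 0 := C_injective (by rw [C_0, ← h4]; exact map_ofNat C 2)
  refine W.isUnit_Δ.ne_zero ?_
  rw [Δ, b₂, b₄, b₆, b₈, ha1, ha3]
  linear_combination (norm := ring1) (8 * W.a₂ ^ 2 * W.a₄ ^ 2 - 32 * W.a₄ ^ 3 -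
    32 * W.a₂ ^ 3 * W.a₆ + 144 * W.a₂ * W.a₄ * W.a₆ - 216 * W.a₆ ^ 2) * hF2

end FunctionField
end WeierstrassCurve.Affine

namespace WeierstrassCurve.Affine

open scoped Polynomial.Bivariate

variable {F : Type*} [Field F] [Fintype F] {W : WeierstrassCurve.Affine F} {U V : F[X]}

/-- The numerator of the `x`-coordinate of the difference of the Frobenius point and the generic
point over the denominator `(X ^ q - X) ^ 2`, when `y ^ q = U + V * y` in the function field. -/
noncomputable def frobeniusSubNumerator (W : WeierstrassCurve.Affine F) (U V : F[X]) : F[X] :=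
  -((U + (C W.a₁ * X + C W.a₃)) ^ 2 -
      (U + (C W.a₁ * X + C W.a₃)) * (V + 1) * (C W.a₁ * X + C W.a₃) -
      (V + 1) ^ 2 * (X ^ 3 + C W.a₂ * X ^ 2 + C W.a₄ * X + C W.a₆)) -
    (C W.a₂ + X + X ^ Fintype.card F) * (X ^ Fintype.card F - X) ^ 2

namespace FunctionField

lemma conj_y_pow_card : conj W (y W) ^ Fintype.card F =
    -y W ^ Fintype.card F -
      algebraMap F[X] W.FunctionField (C W.a₁ * X ^ Fintype.card F + C W.a₃) := by
  have h := congrArg (FiniteField.frobeniusAlgHom F W.FunctionField) (conj_y (W := W))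
  simp only [map_sub, map_neg, map_add, map_mul, algebraMap_C, AlgHom.commutes] at h
  simp only [FiniteField.frobeniusAlgHom_apply] at h
  simpa only [map_add, map_mul, map_pow, algebraMap_C] using h

lemma trace_pow_card (h : y W ^ Fintype.card F = algebraMap F[X] W.FunctionField U +
      algebraMap F[X] W.FunctionField V * y W) :
    C W.a₁ * X ^ Fintype.card F + C W.a₃ = V * (C W.a₁ * X + C W.a₃) - 2 * U := by
  refine FaithfulSMul.algebraMap_injective F[X] W.FunctionField ?_
  have h2 := congrArg (conj W) h
  rw [map_pow, conj_y_pow_card, map_add (conj W), map_mul (conj W), AlgHom.commutes,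
    AlgHom.commutes, conj_y, h] at h2
  rw [map_sub, map_mul, map_mul, map_ofNat]
  linear_combination -h2

lemma norm_pow_card (h : y W ^ Fintype.card F = algebraMap F[X] W.FunctionField U +
      algebraMap F[X] W.FunctionField V * y W) :
    U ^ 2 - U * V * (C W.a₁ * X + C W.a₃) -
      V ^ 2 * (X ^ 3 + C W.a₂ * X ^ 2 + C W.a₄ * X + C W.a₆) =
      -(X ^ (3 * Fintype.card F) + C W.a₂ * X ^ (2 * Fintype.card F) +
        C W.a₄ * X ^ Fintype.card F + C W.a₆) := by
  refine FaithfulSMul.algebraMap_injective F[X] W.FunctionField ?_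
  have h1 := mul_conj (W := W) 0 1
  have h2 := mul_conj (W := W) U V
  rw [← h, map_pow, ← mul_pow] at h2
  rw [map_zero, map_one, zero_add, one_mul] at h1
  rw [h1] at h2
  rw [← h2, ← map_pow]
  congr 1
  have h3 := FiniteField.expand_card (X ^ 3 + C W.a₂ * X ^ 2 + C W.a₄ * X + C W.a₆)
  have h4 := map_neg (FiniteField.frobeniusAlgHom F F[X])
    (X ^ 3 + C W.a₂ * X ^ 2 + C W.a₄ * X + C W.a₆)
  simp only [FiniteField.frobeniusAlgHom_apply] at h4
  rw [← h3] at h4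
  have h5 : (0 : F[X]) ^ 2 - 0 * 1 * (C W.a₁ * X + C W.a₃) -
    1 ^ 2 * (X ^ 3 + C W.a₂ * X ^ 2 + C W.a₄ * X + C W.a₆) =
      -(X ^ 3 + C W.a₂ * X ^ 2 + C W.a₄ * X + C W.a₆) := by ring
  rw [h5, h4]
  simp only [map_add, map_mul, map_pow, expand_X, expand_C, ← pow_mul]
  ring

lemma frobeniusSubNumerator_eq (h : y W ^ Fintype.card F = algebraMap F[X] W.FunctionField U +
      algebraMap F[X] W.FunctionField V * y W) :
    frobeniusSubNumerator W U V = X ^ (2 * Fintype.card F + 1) +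
      (X ^ (Fintype.card F + 2) + C (2 * W.a₂) * X ^ (Fintype.card F + 1) +
      C W.a₄ * X ^ Fintype.card F + (C W.a₄ * X + C (2 * W.a₆)) +
      (2 * (V * (X ^ 3 + C W.a₂ * X ^ 2 + C W.a₄ * X + C W.a₆)) - U * (C W.a₁ * X + C W.a₃) +
        V * (C W.a₁ * X + C W.a₃) ^ 2)) := by
  rw [frobeniusSubNumerator, map_mul, map_mul, map_ofNat]
  linear_combination -norm_pow_card h

lemma natDegree_le (h : y W ^ Fintype.card F = algebraMap F[X] W.FunctionField U +
      algebraMap F[X] W.FunctionField V * y W) :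
    2 * U.natDegree ≤ 3 * Fintype.card F ∧ (V ≠ 0 → 2 * V.natDegree + 3 ≤ 3 * Fintype.card F) := by
  have h1 := CoordinateRing.degree_norm_smul_basis (W' := W) U V
  rw [CoordinateRing.norm_smul_basis, norm_pow_card h, degree_neg] at h1
  have h2 : (X ^ (3 * Fintype.card F) + C W.a₂ * X ^ (2 * Fintype.card F) +
      C W.a₄ * X ^ Fintype.card F + C W.a₆).degree ≤
      ((3 * Fintype.card F : ℕ) : WithBot ℕ) := by
    have := Fintype.card_pos (α := F)
    refine natDegree_le_iff_degree_le.mp ?_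
    compute_degree
    lia
  rw [h1, max_le_iff] at h2
  refine ⟨?_, fun hV ↦ ?_⟩
  · rw [← degree_pow, ← natDegree_le_iff_degree_le, natDegree_pow] at h2
    exact h2.1
  · have := h2.2
    rw [degree_eq_natDegree hV, nsmul_eq_mul] at this
    exact_mod_cast this

lemma natDegree_frobeniusSubNumerator (h : y W ^ Fintype.card F =
      algebraMap F[X] W.FunctionField U + algebraMap F[X] W.FunctionField V * y W) :
    (frobeniusSubNumerator W U V).natDegree = 2 * Fintype.card F + 1 := by
  obtain ⟨hU, hV⟩ := natDegree_le h
  have hq : 1 < Fintype.card F := Fintype.one_lt_card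
  rw [frobeniusSubNumerator_eq h]
  refine (natDegree_add_eq_left_of_natDegree_lt ?_).trans (natDegree_X_pow _)
  rw [natDegree_X_pow, Nat.lt_succ_iff]
  have h1 : (C W.a₁ * X + C W.a₃).natDegree ≤ 1 := natDegree_linear_le
  have h2 : (X ^ 3 + C W.a₂ * X ^ 2 + C W.a₄ * X + C W.a₆).natDegree ≤ 3 := by
    compute_degree
  have hV' (n : ℕ) (p : F[X]) (hp : p.natDegree ≤ n) (hn : 2 * n ≤ Fintype.card F + 4) :
      (V * p).natDegree ≤ 2 * Fintype.card F := by
    by_cases hV0 : V = 0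
    · simp [hV0]
    · have := natDegree_mul_le (p := V) (q := p)
      have := hV hV0
      lia
  refine natDegree_add_le_of_degree_le ?_ (natDegree_add_le_of_degree_le
    ((natDegree_sub_le_of_le ?_ ?_).trans_eq (max_self _)) ?_)
  · compute_degree
    lia
  · exact (natDegree_C_mul_le (2 : F) _).trans (hV' 3 _ h2 (by lia))
  · have := natDegree_mul_le (p := U) (q := C W.a₁ * X + C W.a₃)
    lia
  · refine hV' 2 _ ?_ (by lia)
    have := natDegree_pow_le (p := C W.a₁ * X + C W.a₃) (n := 2)
    lia

lemma polynomial_dvd (h : y W ^ Fintype.card F = algebraMap F[X] W.FunctionField U +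
      algebraMap F[X] W.FunctionField V * y W) :
    W.polynomial ∣ Y ^ Fintype.card F - (C U + C V * Y) := by
  refine AdjoinRoot.mk_eq_mk.mp
    (FaithfulSMul.algebraMap_injective W.CoordinateRing W.FunctionField ?_)
  change algebraMap W.CoordinateRing W.FunctionField (CoordinateRing.mk W _) =
    algebraMap W.CoordinateRing W.FunctionField (CoordinateRing.mk W _)
  rw [map_pow, map_pow, map_add, map_add, map_mul, map_mul, algebraMap_coordinateRing_C,
    algebraMap_coordinateRing_C]
  exact h

lemma map_polynomial_dvd (h : y W ^ Fintype.card F = algebraMap F[X] W.FunctionField U +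
      algebraMap F[X] W.FunctionField V * y W) (a : F) :
    X ^ 2 + C (W.a₁ * a + W.a₃) * X - C (a ^ 3 + W.a₂ * a ^ 2 + W.a₄ * a + W.a₆) ∣
      X ^ Fintype.card F - (C (U.eval a) + C (V.eval a) * X) := by
  have := Polynomial.map_dvd (evalRingHom a) (polynomial_dvd h)
  rw [WeierstrassCurve.Affine.polynomial.eq_def W] at this
  simpa using this

lemma eval_add_eval_mul (h : y W ^ Fintype.card F = algebraMap F[X] W.FunctionField U +
      algebraMap F[X] W.FunctionField V * y W) {a b : F} (hab : W.Equation a b) :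
    U.eval a + V.eval a * b = b := by
  have := eval_dvd (x := b) (map_polynomial_dvd h a)
  rw [equation_iff'] at hab
  have h0 : eval b (X ^ 2 + C (W.a₁ * a + W.a₃) * X -
      C (a ^ 3 + W.a₂ * a ^ 2 + W.a₄ * a + W.a₆)) = 0 := by
    simp only [eval_add, eval_sub, eval_mul, eval_pow, eval_C, eval_X]
    linear_combination hab
  rw [h0, zero_dvd_iff] at this
  simp only [eval_add, eval_sub, eval_mul, eval_pow, eval_C, eval_X, FiniteField.pow_card] at this
  linear_combination -this

lemma X_pow_card_sub_X_eq_prod : (X ^ Fintype.card F - X : F[X]) = ∏ b : F, (X - C b) := by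
  have hm : (X ^ Fintype.card F - X : F[X]).Monic := monic_X_pow_sub (by
    rw [degree_X]
    exact_mod_cast Fintype.one_lt_card (α := F))
  have := prod_multiset_X_sub_C_of_monic_of_roots_card_eq hm (by
    rw [FiniteField.roots_X_pow_card_sub_X,
      FiniteField.X_pow_card_sub_X_natDegree_eq F Fintype.one_lt_card]
    rfl)
  rw [← this, FiniteField.roots_X_pow_card_sub_X]
  rfl

lemma eval_X_pow_card_sub_X (a : F) : eval a (X ^ Fintype.card F - X) = 0 := by
  simp [FiniteField.pow_card]

lemma eval_frobeniusSubNumerator (a : F) : (frobeniusSubNumerator W U V).eval a =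
    -((U.eval a + (W.a₁ * a + W.a₃)) ^ 2 -
      (U.eval a + (W.a₁ * a + W.a₃)) * (V.eval a + 1) * (W.a₁ * a + W.a₃) -
      (V.eval a + 1) ^ 2 * (a ^ 3 + W.a₂ * a ^ 2 + W.a₄ * a + W.a₆)) := by
  simp only [frobeniusSubNumerator, eval_add, eval_sub, eval_mul, eval_pow, eval_C, eval_X,
    FiniteField.pow_card, eval_neg, eval_one]
  ring

/-- The numerator does not vanish at an element above which the curve has two points. -/
lemma eval_frobeniusSubNumerator_ne_zero (h : y W ^ Fintype.card F =
      algebraMap F[X] W.FunctionField U + algebraMap F[X] W.FunctionField V * y W) {a b c : F}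
    (hb : W.Equation a b) (hc : W.Equation a c) (hbc : b ≠ c) :
    (frobeniusSubNumerator W U V).eval a ≠ 0 := by
  have h1 := eval_add_eval_mul h hb
  have h2 := eval_add_eval_mul h hc
  have hV : V.eval a = 1 := by
    refine sub_eq_zero.mp ((mul_eq_zero.mp ?_).resolve_right (sub_ne_zero.mpr hbc))
    linear_combination h1 - h2
  have hU : U.eval a = 0 := by
    rw [hV] at h1
    linear_combination h1
  rw [equation_iff'] at hb hc
  have hs : b + c = -(W.a₁ * a + W.a₃) := by
    refine mul_left_cancel₀ (sub_ne_zero.mpr hbc) ?_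
    linear_combination hb - hc
  have hd : (frobeniusSubNumerator W U V).eval a = (b - c) ^ 2 := by
    rw [eval_frobeniusSubNumerator, hU, hV]
    linear_combination (b - c + (2 * b + (W.a₁ * a + W.a₃))) * hs - 4 * hb
  rw [hd]
  exact pow_ne_zero 2 (sub_ne_zero.mpr hbc)

/-- At the `x`-coordinate of a two-torsion point, the numerator has a simple zero. -/
lemma rootMultiplicity_frobeniusSubNumerator_eq_one [W.IsElliptic] (h : y W ^ Fintype.card F =
      algebraMap F[X] W.FunctionField U + algebraMap F[X] W.FunctionField V * y W) {a b : F}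
    (hb : W.Equation a b) (hb2 : 2 * b + W.a₁ * a + W.a₃ = 0) :
    (frobeniusSubNumerator W U V).rootMultiplicity a = 1 := by
  have h0 : frobeniusSubNumerator W U V ≠ 0 := by
    intro h0
    have := natDegree_frobeniusSubNumerator h
    simp [h0] at this
  have hU := eval_add_eval_mul h hb
  have hns := (((nonsingular_iff' ..).mp (equation_iff_nonsingular.mp hb)).2).resolve_right
    (not_not.mpr hb2)
  rw [equation_iff'] at hb
  have hV : V.eval a = 0 := by
    obtain ⟨r, hr⟩ := map_polynomial_dvd h a
    have hd := congrArg (fun p ↦ eval b (derivative p)) hr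
    have hG : eval b (X ^ 2 + C (W.a₁ * a + W.a₃) * X -
        C (a ^ 3 + W.a₂ * a ^ 2 + W.a₄ * a + W.a₆)) = 0 := by
      simp only [eval_add, eval_sub, eval_mul, eval_pow, eval_C, eval_X]
      linear_combination hb
    have hG' : eval b (derivative (X ^ 2 + C (W.a₁ * a + W.a₃) * X -
        C (a ^ 3 + W.a₂ * a ^ 2 + W.a₄ * a + W.a₆))) = 0 := by
      simp only [derivative_add, derivative_sub, derivative_C_mul, derivative_X_pow, derivative_X,
        derivative_C, eval_add, eval_sub, eval_mul, eval_pow, eval_C, eval_X, eval_one, eval_zero]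
      linear_combination hb2
    simp only [derivative_mul, eval_add, eval_mul, hG, hG'] at hd
    simpa [derivative_X_pow, FiniteField.cast_card_eq_zero, -map_natCast] using hd
  rw [hV, zero_mul, add_zero] at hU
  refine le_antisymm (not_lt.mp fun hlt ↦ ?_) ((rootMultiplicity_pos h0).mpr ?_)
  · have hd := ((one_lt_rootMultiplicity_iff_isRoot h0).mp hlt).2
    rw [IsRoot.def, frobeniusSubNumerator] at hd
    simp only [derivative_add, derivative_sub, derivative_mul, derivative_neg, derivative_pow,
      derivative_X, derivative_C, derivative_one, eval_add, eval_sub, eval_mul, eval_neg, eval_pow,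
      eval_C, eval_X, eval_one, eval_zero, FiniteField.pow_card, hU, hV] at hd
    refine hns ?_
    linear_combination -hd - eval a (derivative U) * hb2 +
      eval a (derivative V) * ((b + W.a₁ * a + W.a₃) * hb2 - 2 * hb)
  · rw [IsRoot.def, eval_frobeniusSubNumerator, hU, hV]
    linear_combination -hb

/-- Over an element which is not the `x`-coordinate of any point, the numerator has a double
zero. -/
lemma sq_dvd_frobeniusSubNumerator (h : y W ^ Fintype.card F =
      algebraMap F[X] W.FunctionField U + algebraMap F[X] W.FunctionField V * y W) {a : F}
    (ha : ∀ b, ¬ W.Equation a b) : (X - C a) ^ 2 ∣ frobeniusSubNumerator W U V := by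
  set G : F[X] := X ^ 2 + C (W.a₁ * a + W.a₃) * X -
    C (a ^ 3 + W.a₂ * a ^ 2 + W.a₄ * a + W.a₆) with hG
  have hdeg : G.degree ≠ 0 := by
    have : G.degree = 2 := by
      rw [hG]
      compute_degree!
    simp [this]
  obtain ⟨t, ht⟩ := IsAlgClosed.exists_aeval_eq_zero (AlgebraicClosure F) G hdeg
  have hroot : ∀ b, algebraMap F (AlgebraicClosure F) b ≠ t := by
    rintro b rfl
    refine ha b ((equation_iff' ..).mpr ?_)
    rw [aeval_algebraMap_apply, map_eq_zero] at ht
    simp only [hG, aeval_def, eval₂_eq_eval_map, Algebra.algebraMap_self, Polynomial.map_id,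
      eval_add, eval_sub, eval_mul, eval_pow, eval_C, eval_X] at ht
    linear_combination ht
  have hpow : t ^ Fintype.card F = algebraMap F _ (U.eval a) + algebraMap F _ (V.eval a) * t := by
    have := _root_.map_dvd (aeval t) (map_polynomial_dvd h a)
    rw [← hG, ht, zero_dvd_iff] at this
    simp only [map_sub, map_add, map_mul, map_pow, aeval_C, aeval_X] at this
    linear_combination this
  have ht2 : aeval (t ^ Fintype.card F) G = 0 := by
    have := congrArg (FiniteField.frobeniusAlgHom F (AlgebraicClosure F)) ht
    rwa [map_zero, ← aeval_algHom_apply] at this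
  have hne : t ^ Fintype.card F ≠ t := by
    intro hfix
    have : (X ^ Fintype.card F - X : F[X]).aeval t = 0 := by simp [hfix]
    rw [X_pow_card_sub_X_eq_prod, map_prod, Finset.prod_eq_zero_iff] at this
    obtain ⟨b, -, hb⟩ := this
    rw [map_sub, aeval_X, aeval_C] at hb
    exact hroot b (sub_eq_zero.mp hb).symm
  simp only [hG, map_sub, map_add, map_mul, map_pow, aeval_C, aeval_X] at ht ht2
  have hsum : t ^ Fintype.card F + t = -algebraMap F (AlgebraicClosure F) (W.a₁ * a + W.a₃) := by
    refine mul_left_cancel₀ (sub_ne_zero.mpr hne) ?_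
    simp only [map_add, map_mul]
    linear_combination ht2 - ht
  have hV : V.eval a = -1 := by
    by_contra hV
    refine hroot (-(W.a₁ * a + W.a₃ + U.eval a) / (V.eval a + 1)) ?_
    have hV' : algebraMap F (AlgebraicClosure F) (V.eval a + 1) ≠ 0 := by
      rw [ne_eq, map_eq_zero]
      exact fun h ↦ hV (eq_neg_of_add_eq_zero_left h)
    rw [map_div₀, div_eq_iff hV', map_neg, map_add _ _ (U.eval a), map_add _ _ 1, map_one]
    linear_combination hpow - hsum
  have hU : U.eval a = -(W.a₁ * a + W.a₃) := by
    refine (algebraMap F (AlgebraicClosure F)).injective ?_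
    rw [hV, map_neg, map_one] at hpow
    rw [map_neg]
    linear_combination hsum - hpow
  have h1 : X - C a ∣ U + (C W.a₁ * X + C W.a₃) := by
    rw [dvd_iff_isRoot, IsRoot.def]
    simp [hU]
  have h2 : X - C a ∣ V + 1 := by
    rw [dvd_iff_isRoot, IsRoot.def]
    simp [hV]
  have h3 : X - C a ∣ X ^ Fintype.card F - X := by
    rw [dvd_iff_isRoot, IsRoot.def, eval_X_pow_card_sub_X]
  refine dvd_sub ((dvd_neg).mpr (dvd_sub (dvd_sub (pow_dvd_pow_of_dvd h1 2) ?_)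
    ((pow_dvd_pow_of_dvd h2 2).mul_right _))) ((pow_dvd_pow_of_dvd h3 2).mul_left _)
  rw [sq]
  exact (mul_dvd_mul h1 h2).mul_right _

end FunctionField
end WeierstrassCurve.Affine

namespace WeierstrassCurve.Affine

open scoped Polynomial.Bivariate

variable {F : Type*} [Field F] {W : WeierstrassCurve.Affine F}

lemma card_fiber_of_equation {a b : F} (hb : W.Equation a b) :
    Nat.card {y // W.Equation a y} = ({b, W.negY a b} : Set F).ncard := by
  rw [← Nat.card_coe_set_eq]
  have : ({b, W.negY a b} : Set F) = {y | W.Equation a y} := by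
    ext c
    refine ⟨?_, fun hc ↦ Y_eq_of_X_eq hc hb rfl⟩
    rintro (rfl | rfl)
    exacts [hb, (equation_neg ..).mpr hb]
  rw [this]
  rfl

variable [Fintype F] {U V : F[X]}

lemma card_point_eq_sum [W.IsElliptic] :
    Nat.card W.Point = ∑ a : F, Nat.card {y // W.Equation a y} + 1 := by
  rw [← Nat.card_sigma, Nat.card_congr W.pointEquiv]
  refine (Finite.card_option (α := {xy : F × F // W.Equation xy.1 xy.2})).trans ?_
  rw [Nat.card_congr (Equiv.subtypeProdEquivSigmaSubtype W.Equation)]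

namespace FunctionField

lemma order_frobeniusSubNumerator [W.IsElliptic] (h : y W ^ Fintype.card F =
      algebraMap F[X] W.FunctionField U + algebraMap F[X] W.FunctionField V * y W) (a : F) :
    Nat.card {y // W.Equation a y} ≤ 2 ∧
    (X - C a) ^ (2 - Nat.card {y // W.Equation a y}) ∣ frobeniusSubNumerator W U V ∧
    (Nat.card {y // W.Equation a y} ≠ 0 →
      ¬ (X - C a) ^ (2 - Nat.card {y // W.Equation a y} + 1) ∣ frobeniusSubNumerator W U V) := by
  have h0 : frobeniusSubNumerator W U V ≠ 0 := by
    intro h0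
    have := natDegree_frobeniusSubNumerator h
    simp [h0] at this
  by_cases ha : ∀ b, ¬ W.Equation a b
  · have : IsEmpty {y // W.Equation a y} := ⟨fun y ↦ ha y y.2⟩
    rw [Nat.card_of_isEmpty]
    exact ⟨Nat.zero_le 2, sq_dvd_frobeniusSubNumerator h ha, fun h ↦ absurd rfl h⟩
  push Not at ha
  obtain ⟨b, hb⟩ := ha
  rw [card_fiber_of_equation hb]
  by_cases hne : b = W.negY a b
  · have hm := rootMultiplicity_frobeniusSubNumerator_eq_one h hb (by
      rw [negY] at hne
      linear_combination hne)
    rw [← hne, Set.pair_eq_singleton, Set.ncard_singleton]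
    refine ⟨one_le_two, ?_, fun _ ↦ ?_⟩
    · exact (le_rootMultiplicity_iff h0).mp hm.ge
    · rw [← le_rootMultiplicity_iff h0, hm]
      simp
  · rw [Set.ncard_pair hne]
    refine ⟨le_rfl, by simp, fun _ ↦ ?_⟩
    rw [Nat.sub_self, zero_add, pow_one, dvd_iff_isRoot]
    exact eval_frobeniusSubNumerator_ne_zero h hb ((equation_neg ..).mpr hb) hne

lemma exists_isCoprime_frobeniusSubNumerator [W.IsElliptic] (h : y W ^ Fintype.card F =
      algebraMap F[X] W.FunctionField U + algebraMap F[X] W.FunctionField V * y W) :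
    ∃ a b : F[X], IsCoprime a b ∧ b ≠ 0 ∧ max a.natDegree b.natDegree = Nat.card W.Point ∧
      frobeniusSubNumerator W U V * b = a * (X ^ Fintype.card F - X) ^ 2 := by
  set n : F → ℕ := fun a ↦ Nat.card {y // W.Equation a y} with hn
  have hord := order_frobeniusSubNumerator h
  have hmon (m : F → ℕ) (a : F) : ((X - C a) ^ m a).Monic := (monic_X_sub_C a).pow _
  have hdeg (m : F → ℕ) : (∏ a : F, (X - C a) ^ m a).natDegree = ∑ a, m a := by
    rw [natDegree_prod_of_monic _ _ fun a _ ↦ hmon m a]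
    simp
  obtain ⟨a, ha⟩ : ∏ x : F, (X - C x) ^ (2 - n x) ∣ frobeniusSubNumerator W U V :=
    Finset.prod_dvd_of_coprime
      (fun x _ y _ hxy ↦ (pairwise_coprime_X_sub_C Function.injective_id hxy).pow)
      fun x _ ↦ (hord x).2.1
  have hprod : (∏ x : F, (X - C x) ^ (2 - n x)) * ∏ x : F, (X - C x) ^ n x =
      (X ^ Fintype.card F - X) ^ 2 := by
    rw [X_pow_card_sub_X_eq_prod, ← Finset.prod_mul_distrib, ← Finset.prod_pow]
    refine Finset.prod_congr rfl fun x _ ↦ ?_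
    rw [← pow_add, Nat.sub_add_cancel (hord x).1]
  have ha0 : a ≠ 0 := by
    rintro rfl
    have := natDegree_frobeniusSubNumerator h
    simp [ha] at this
  refine ⟨a, ∏ x : F, (X - C x) ^ n x, IsCoprime.prod_right fun x _ ↦ ?_,
    (monic_prod_of_monic _ _ fun x _ ↦ hmon n x).ne_zero, ?_, ?_⟩
  · by_cases hx : n x = 0
    · rw [hx, pow_zero]
      exact isCoprime_one_right
    · refine IsCoprime.pow_right (((irreducible_X_sub_C x).coprime_iff_not_dvd.mpr ?_).symm)
      intro hdvd
      refine (hord x).2.2 hx ?_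
      rw [pow_succ, ha]
      exact mul_dvd_mul (Finset.dvd_prod_of_mem (fun x ↦ (X - C x) ^ (2 - n x))
        (Finset.mem_univ x)) hdvd
  · have h1 := natDegree_frobeniusSubNumerator h
    rw [ha, (monic_prod_of_monic _ _ fun x _ ↦ hmon (2 - n ·) x).natDegree_mul' ha0,
      hdeg (2 - n ·)] at h1
    have h2 : ∑ x, (2 - n x) + ∑ x, n x = 2 * Fintype.card F := by
      rw [← Finset.sum_add_distrib, Finset.sum_congr rfl fun x _ ↦ Nat.sub_add_cancel (hord x).1]
      simp [mul_comm]
    have h3 := card_point_eq_sum (W := W)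
    rw [hdeg, max_eq_left]
    all_goals lia
  · rw [ha, ← hprod]
    ring

end FunctionField
end WeierstrassCurve.Affine

namespace WeierstrassCurve.Affine.FunctionField

variable {F : Type*} [Field F] (W : WeierstrassCurve.Affine F) [W.IsElliptic]

instance : (W⁄W.FunctionField).IsElliptic :=
  inferInstanceAs (W.map (algebraMap F W.FunctionField)).IsElliptic

/-- The generic point, with coordinates in the function field. -/
noncomputable def genericPoint : (W⁄W.FunctionField).Point :=
  .some (x W) (y W) (equation_iff_nonsingular.mp equation)

open scoped Classical in
/-- The action of the hyperelliptic involution on points over the function field. -/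
noncomputable def conjPoint : (W⁄W.FunctionField).Point →+ (W⁄W.FunctionField).Point :=
  Point.map (W' := W) ((conj W).restrictScalars F)

variable {W}

lemma neg_genericPoint :
    ∃ h, -genericPoint W = .some (x W) (conj W (y W)) h := by
  have : (W⁄W.FunctionField).negY (x W) (y W) = conj W (y W) := by
    rw [conj_y, map_add, map_mul, algebraMap_C, algebraMap_C]
    change -y W - algebraMap F _ _ * x W - algebraMap F _ _ = _
    rw [x]
    ring
  rw [← this]
  exact ⟨_, rfl⟩

lemma conjPoint_genericPoint : conjPoint W (genericPoint W) = -genericPoint W := by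
  obtain ⟨h, hneg⟩ := neg_genericPoint (W := W)
  rw [hneg]
  change Point.some (conj W (x W)) (conj W (y W)) _ = _
  simp only [x, AlgHom.commutes]

lemma hasHeight_genericPoint : (genericPoint W).HasHeight (F := F) 1 :=
  Point.hasHeight_some _ (a := X) (b := 1) isCoprime_one_right one_ne_zero
    (by rw [map_one, one_mul, x]) (by simp)

/-- Anti-invariant points under the hyperelliptic involution have a height. -/
lemma exists_hasHeight {P : (W⁄W.FunctionField).Point} (hP : conjPoint W P = -P) :
    ∃ n, P.HasHeight (F := F) n := by
  obtain _ | ⟨a, b, h⟩ := P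
  · exact ⟨0, Point.hasHeight_zero⟩
  · obtain ⟨r, s, hs, hrs⟩ := exists_of_conj_eq (z := a) (Point.some.inj hP).1
    exact Point.exists_hasHeight_some h hs hrs

open scoped Classical in
/-- On the group of anti-invariant points under the hyperelliptic involution, the height satisfies
the Cauchy-Schwarz inequality. -/
lemma sq_le_four_mul_of_hasHeight {P : (W⁄W.FunctionField).Point} (hP : conjPoint W P = -P)
    {m n : ℕ} (hm : P.HasHeight (F := F) m) (hn : (P - genericPoint W).HasHeight (F := F) n) :
    ((n : ℤ) - m - 1) ^ 2 ≤ 4 * m := by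
  let M : AddSubgroup (W⁄W.FunctionField).Point := (conjPoint W + AddMonoidHom.id _).ker
  have hM {P} : P ∈ M ↔ conjPoint W P = -P := by
    rw [AddMonoidHom.mem_ker, eq_neg_iff_add_eq_zero]
    rfl
  choose h hh using fun P : M ↦ exists_hasHeight (hM.mp P.2)
  have huniq (P : M) {n : ℕ} (hn : (P : (W⁄W.FunctionField).Point).HasHeight (F := F) n) :
      h P = n := (hh P).unique hn
  let p : M := ⟨P, hM.mpr hP⟩
  let g : M := ⟨genericPoint W, hM.mpr conjPoint_genericPoint⟩
  have hpar (P Q : M) : (h (P + Q) : ℤ) + h (P - Q) = 2 * h P + 2 * h Q := by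
    have := Point.HasHeight.parallelogram (hh P) (hh Q) (hh (P + Q)) (hh (P - Q))
    lia
  have hg : h g = 1 := huniq g hasHeight_genericPoint
  have h0 : h 0 = 0 := huniq 0 Point.hasHeight_zero
  have hneg : (h (-g) : ℤ) = 1 := by
    have := hpar 0 g
    rw [zero_add, zero_sub] at this
    lia
  have := sq_le_four_mul_of_parallelogram hpar (fun _ ↦ Int.natCast_nonneg _) p (-g) hneg
  rwa [hneg, huniq p hm, ← sub_eq_add_neg, huniq (p - g) hn] at this

variable [Fintype F]

variable (W) in
open scoped Classical in
/-- The image of the generic point under the Frobenius endomorphism. -/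
noncomputable def frobeniusPoint : (W⁄W.FunctionField).Point :=
  Point.map (W' := W) (FiniteField.frobeniusAlgHom F W.FunctionField) (genericPoint W)

lemma frobeniusPoint_eq : ∃ h, frobeniusPoint W =
    .some (x W ^ Fintype.card F) (y W ^ Fintype.card F) h :=
  ⟨_, rfl⟩

lemma conjPoint_frobeniusPoint : conjPoint W (frobeniusPoint W) = -frobeniusPoint W := by
  classical
  rw [frobeniusPoint, ← map_neg, ← conjPoint_genericPoint, conjPoint, Point.map_map,
    Point.map_map]
  refine congrArg (fun f ↦ Point.map (W' := W) f (genericPoint W)) (AlgHom.ext fun z ↦ ?_)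
  exact map_pow (conj W) z _

lemma hasHeight_frobeniusPoint : (frobeniusPoint W).HasHeight (F := F) (Fintype.card F) := by
  obtain ⟨h, hfr⟩ := frobeniusPoint_eq (W := W)
  rw [hfr]
  exact Point.hasHeight_some _ (a := X ^ Fintype.card F) (b := 1) isCoprime_one_right one_ne_zero
    (by rw [map_one, one_mul, x, map_pow]) (by simp)

open scoped Classical in
lemma hasHeight_frobeniusPoint_sub_genericPoint :
    (frobeniusPoint W - genericPoint W).HasHeight (F := F) (Nat.card W.Point) := by
  obtain ⟨U, V, h⟩ := exists_eq_add_mul_y (W := W)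
    (CoordinateRing.mk W Polynomial.X ^ Fintype.card F)
  rw [map_pow] at h
  change y W ^ Fintype.card F = _ at h
  obtain ⟨a, b, hab, hb, hdeg, heq⟩ := exists_isCoprime_frobeniusSubNumerator h
  obtain ⟨h₁, hfr⟩ := frobeniusPoint_eq (W := W)
  obtain ⟨h₂, hneg⟩ := neg_genericPoint (W := W)
  have hu : x W ^ Fintype.card F - x W = algebraMap F[X] W.FunctionField
      (X ^ Fintype.card F - X) := by
    rw [x, map_sub, map_pow]
  have hu0 : x W ^ Fintype.card F - x W ≠ 0 := by
    rw [hu, ne_eq, FaithfulSMul.algebraMap_eq_zero_iff]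
    exact FiniteField.X_pow_card_sub_X_ne_zero F Fintype.one_lt_card
  have hne : x W ^ Fintype.card F ≠ x W := sub_ne_zero.mp hu0
  rw [sub_eq_add_neg, hfr, hneg, Point.add_of_X_ne hne]
  refine Point.hasHeight_some _ hab hb ?_ hdeg
  rw [slope_of_X_ne hne, addX]
  refine mul_right_cancel₀ (pow_ne_zero 2 hu0) ?_
  have heq' := congrArg (algebraMap F[X] W.FunctionField) heq
  rw [map_mul, map_mul, map_pow, ← hu] at heq'
  rw [← heq', mul_comm, mul_assoc]
  congr 1
  have htr := congrArg (algebraMap F[X] W.FunctionField) (trace_pow_card h)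
  have hy := y_sq (W := W)
  rw [conj_y, h]
  change _ = (_ + algebraMap F _ W.a₁ * _ - algebraMap F _ W.a₂ - _ - _) * _
  rw [frobeniusSubNumerator]
  simp only [map_add, map_sub, map_neg, map_mul, map_pow, map_one, map_ofNat, algebraMap_C,
    ← x.eq_def] at htr hy ⊢
  field_simp
  linear_combination -(algebraMap F[X] W.FunctionField V + 1) ^ 2 * hy -
    (algebraMap F[X] W.FunctionField U + algebraMap F[X] W.FunctionField V * y W + y W +
      (algebraMap F W.FunctionField W.a₁ * x W + algebraMap F W.FunctionField W.a₃)) * htr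

end WeierstrassCurve.Affine.FunctionField

end

/-- **Hasse–Weil bound.** For an elliptic curve `E` over a finite field `F_q` with `N`
rational points (including the point at infinity), `|N - (q + 1)| ≤ 2 * √q`. -/
theorem hasse_weil_bound {F : Type*} [Field F] [Fintype F] (W : WeierstrassCurve.Affine F)
    [W.IsElliptic] :
    |(Nat.card W.Point : ℝ) - (Fintype.card F + 1)| ≤ 2 * Real.sqrt (Fintype.card F) := by
  open WeierstrassCurve.Affine.FunctionField in
  have h := sq_le_four_mul_of_hasHeight (W := W) conjPoint_frobeniusPoint
    hasHeight_frobeniusPoint hasHeight_frobeniusPoint_sub_genericPoint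
  have h' : ((Nat.card W.Point : ℝ) - Fintype.card F - 1) ^ 2 ≤ 4 * Fintype.card F := by
    exact_mod_cast h
  refine abs_le_of_sq_le_sq ?_ (by positivity)
  rw [mul_pow, Real.sq_sqrt (by positivity)]
  linarith
end

section
/- Let q = 4^{2a+1} and let E : y² + y = x³ over F_q. Then E is a maximal elliptic curve: #E(F_q) = q + 2√q + 1 = (2^{2a+1} + 1)². -/
section ArtinSchreier

variable {F : Type*} [Field F] [CharP F 2]

variable (F) in
/-- The Artin–Schreier map `y ↦ y² + y` in characteristic two. -/
def artinSchreierTwo : F →+ F where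
  toFun y := y ^ 2 + y
  map_zero' := by simp
  map_add' x y := by rw [CharTwo.add_sq]; ring

theorem artinSchreierTwo_apply (y : F) : artinSchreierTwo F y = y ^ 2 + y := rfl

theorem artinSchreierTwo_eq_iff (x y : F) :
    artinSchreierTwo F x = artinSchreierTwo F y ↔ x = y ∨ x = y + 1 := by
  have h2 : (2 : F) = 0 := CharTwo.two_eq_zero
  have key : x ^ 2 + x - (y ^ 2 + y) = (x - y) * (x - (y + 1)) := by
    linear_combination (x - y ^ 2 - y + x * y) * h2
  rw [artinSchreierTwo_apply, artinSchreierTwo_apply, ← sub_eq_zero, key, mul_eq_zero,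
    sub_eq_zero, sub_eq_zero]

theorem ne_zero_and_ne_one_of_sq_add_self_eq_one {ω : F} (hω : ω ^ 2 + ω = 1) :
    ω ≠ 0 ∧ ω ≠ 1 := by
  constructor <;> rintro rfl
  · simp at hω
  · simp [CharTwo.add_self_eq_zero] at hω

variable [Fintype F]

theorem index_range_artinSchreierTwo : (artinSchreierTwo F).range.index = 2 := by
  have hker : Nat.card (artinSchreierTwo F).ker = 2 := by
    have : ((artinSchreierTwo F).ker : Set F) = {0, 1} := by
      ext x
      have := artinSchreierTwo_eq_iff x 0
      rw [map_zero, zero_add] at this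
      simpa using this
    rw [← SetLike.coe_sort_coe, this, Nat.card_coe_set_eq, Set.ncard_pair zero_ne_one]
  have h1 := (artinSchreierTwo F).ker.card_mul_index
  have h2 := (artinSchreierTwo F).range.card_mul_index
  rw [AddSubgroup.index_ker, hker, mul_comm] at h1
  exact Nat.eq_of_mul_eq_mul_left Nat.card_pos (h2.trans h1.symm)

open Classical in
/-- The additive character `z ↦ (-1) ^ Tr z` of a finite field of characteristic two, defined through
its kernel, the image of `y ↦ y² + y`. -/
noncomputable def signTrace (z : F) : ℤ := if z ∈ (artinSchreierTwo F).range then 1 else -1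

theorem signTrace_add (x y : F) : signTrace (x + y) = signTrace x * signTrace y := by
  have h := AddSubgroup.add_mem_iff_of_index_two (index_range_artinSchreierTwo (F := F))
    (a := x) (b := y)
  unfold signTrace
  split_ifs <;> simp_all

theorem signTrace_artinSchreierTwo (y : F) : signTrace (y ^ 2 + y) = 1 :=
  if_pos ⟨y, rfl⟩

theorem signTrace_zero : signTrace (0 : F) = 1 := if_pos (zero_mem _)

theorem signTrace_mul_self (x : F) : signTrace x * signTrace x = 1 := by
  rw [← signTrace_add, CharTwo.add_self_eq_zero, signTrace_zero]

theorem signTrace_sq (x : F) : signTrace (x ^ 2) = signTrace x := by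
  have h := signTrace_artinSchreierTwo x
  rw [signTrace_add] at h
  linear_combination signTrace x * h - signTrace (x ^ 2) * signTrace_mul_self x

variable [DecidableEq F]

theorem card_artinSchreierTwo_fiber (z : F) :
    (({y | y ^ 2 + y = z} : Finset F).card : ℤ) = 1 + signTrace z := by
  unfold signTrace
  split_ifs with h
  · obtain ⟨w, rfl⟩ := h
    have : ({y | y ^ 2 + y = artinSchreierTwo F w} : Finset F) = {w, w + 1} := by
      ext y
      simp only [Finset.mem_filter, Finset.mem_univ, true_and, Finset.mem_insert,
        Finset.mem_singleton]
      exact artinSchreierTwo_eq_iff y w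
    rw [this, Finset.card_pair (by simp)]
    rfl
  · have : ({y | y ^ 2 + y = z} : Finset F) = ∅ := by
      ext y
      simp only [Finset.mem_filter, Finset.mem_univ, true_and, Finset.notMem_empty, iff_false]
      exact fun hy => h ⟨y, hy⟩
    rw [this]
    rfl

theorem sum_signTrace : ∑ z : F, signTrace z = 0 := by
  have h : Fintype.card F = ∑ z : F, ({y | y ^ 2 + y = z} : Finset F).card :=
    Finset.card_eq_sum_card_fiberwise (fun _ _ => Finset.mem_coe.2 (Finset.mem_univ _))
  have h' : (Fintype.card F : ℤ) = ∑ z : F, (1 + signTrace z) := by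
    rw [h, Nat.cast_sum]
    exact Finset.sum_congr rfl fun z _ => card_artinSchreierTwo_fiber z
  rw [Finset.sum_add_distrib] at h'
  simpa using h'

theorem sum_signTrace_polar (h : F) :
    ∑ x : F, signTrace (x ^ 2 * h + x * h ^ 2) = if h ^ 4 = h then (Fintype.card F : ℤ) else 0 := by
  have key (x : F) : signTrace (x ^ 2 * h + x * h ^ 2) = signTrace ((h + h ^ 4) * x ^ 2) := by
    rw [signTrace_add, ← signTrace_sq (x * h ^ 2), ← signTrace_add]
    congr 1
    ring
  simp_rw [key]
  split_ifs with hh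
  · simp [hh, CharTwo.add_self_eq_zero, signTrace_zero]
  · have hc : h + h ^ 4 ≠ 0 := fun h0 => hh (CharTwo.add_eq_zero.1 h0).symm
    have hbij : Function.Bijective fun x : F => (h + h ^ 4) * x ^ 2 := by
      refine Finite.injective_iff_bijective.1 fun x y hxy => ?_
      exact CharTwo.sq_injective (mul_left_cancel₀ hc hxy)
    rw [hbij.sum_comp signTrace, sum_signTrace]

theorem filter_pow_four_eq {ω : F} (hω : ω ^ 2 + ω = 1) :
    ({h | h ^ 4 = h} : Finset F) = {0, 1, ω, ω + 1} := by
  have h2 : (2 : F) = 0 := CharTwo.two_eq_zero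
  ext h
  have key : h ^ 4 - h = h * ((h - 1) * ((h - ω) * (h - (ω + 1)))) := by
    linear_combination (h - h ^ 2) * hω + (h ^ 3 * (ω + 1) - h ^ 2 * (ω + 1)) * h2
  simp only [Finset.mem_filter, Finset.mem_univ, true_and, Finset.mem_insert,
    Finset.mem_singleton]
  rw [← sub_eq_zero, key]
  simp only [mul_eq_zero, sub_eq_zero]

theorem sq_sum_signTrace_cube {ω : F} (hω : ω ^ 2 + ω = 1) :
    (∑ x : F, signTrace (x ^ 3)) ^ 2 = 4 * Fintype.card F := by
  have h2 : (2 : F) = 0 := CharTwo.two_eq_zero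
  obtain ⟨h0, h1⟩ := ne_zero_and_ne_one_of_sq_add_self_eq_one hω
  have hω3 : ω ^ 3 = 1 := by linear_combination (ω - 1) * hω + (ω - 1) * h2
  have hω3' : (ω + 1) ^ 3 = 1 := by
    linear_combination (ω + 2) * hω + (ω + 1) * h2
  have hone : signTrace (1 : F) = 1 := hω ▸ signTrace_artinSchreierTwo ω
  have shift (x : F) : ∑ w : F, signTrace (w ^ 3) = ∑ h : F, signTrace ((x + h) ^ 3) :=
    (Equiv.sum_comp (Equiv.addLeft x) fun w => signTrace (w ^ 3)).symm
  have key (x h : F) : signTrace (x ^ 3) * signTrace ((x + h) ^ 3) =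
      signTrace (h ^ 3) * signTrace (x ^ 2 * h + x * h ^ 2) := by
    rw [← signTrace_add, ← signTrace_add]
    congr 1
    linear_combination (x ^ 3 + x ^ 2 * h + x * h ^ 2) * h2
  calc (∑ x : F, signTrace (x ^ 3)) ^ 2
      = ∑ x : F, ∑ h : F, signTrace (h ^ 3) * signTrace (x ^ 2 * h + x * h ^ 2) := by
        rw [sq, Finset.sum_mul]
        refine Finset.sum_congr rfl fun x _ => ?_
        rw [shift x, Finset.mul_sum]
        exact Finset.sum_congr rfl fun h _ => key x h
    _ = ∑ h : F, if h ^ 4 = h then signTrace (h ^ 3) * Fintype.card F else 0 := by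
        rw [Finset.sum_comm]
        refine Finset.sum_congr rfl fun h _ => ?_
        rw [← Finset.mul_sum, sum_signTrace_polar, mul_ite, mul_zero]
    _ = 4 * Fintype.card F := by
        rw [← Finset.sum_filter, filter_pow_four_eq hω, Finset.sum_insert, Finset.sum_insert,
          Finset.sum_insert, Finset.sum_singleton, hω3, hω3', one_pow, hone,
          zero_pow three_ne_zero, signTrace_zero]
        · ring
        · simp
        · simp [h1.symm, h0]
        · have : (0 : F) ≠ ω + 1 := fun h => h1 (CharTwo.add_eq_zero.1 h.symm)
          simp [h0.symm, this]

theorem three_dvd_card_cube_fiber {ω z : F} (hω : ω ^ 2 + ω = 1) (hz : z ≠ 0) :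
    3 ∣ ({x | x ^ 3 = z} : Finset F).card := by
  have h2 : (2 : F) = 0 := CharTwo.two_eq_zero
  obtain ⟨h0, h1⟩ := ne_zero_and_ne_one_of_sq_add_self_eq_one hω
  rcases ({x | x ^ 3 = z} : Finset F).eq_empty_or_nonempty with he | ⟨w, hw⟩
  · simp [he]
  obtain rfl : w ^ 3 = z := by simpa using hw
  have hw0 : w ≠ 0 := by rintro rfl; simp at hz
  have : ({x | x ^ 3 = w ^ 3} : Finset F) = {w, ω * w, (ω + 1) * w} := by
    ext x
    have key : x ^ 3 - w ^ 3 = (x - w) * ((x - ω * w) * (x - (ω + 1) * w)) := by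
      linear_combination (w ^ 3 - x * w ^ 2) * hω +
        (x ^ 2 * w * (ω + 1) - x * w ^ 2 * (ω + 1)) * h2
    simp only [Finset.mem_filter, Finset.mem_univ, true_and, Finset.mem_insert,
      Finset.mem_singleton]
    rw [← sub_eq_zero, key]
    simp only [mul_eq_zero, sub_eq_zero]
  rw [this, Finset.card_eq_three.2 ⟨w, ω * w, (ω + 1) * w, ?_, ?_, ?_, rfl⟩]
  · exact fun h => h1 (mul_right_cancel₀ hw0 (by rw [one_mul, ← h]))
  · exact fun h => h0 (mul_right_cancel₀ hw0 (by linear_combination -h))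
  · exact fun h => one_ne_zero (mul_right_cancel₀ hw0
      (show (1 : F) * w = 0 * w by linear_combination -h))

theorem sum_signTrace_cube_modEq {ω : F} (hω : ω ^ 2 + ω = 1) :
    ∑ x : F, signTrace (x ^ 3) ≡ 1 [ZMOD 3] := by
  have h : ∑ x : F, signTrace (x ^ 3) =
      ∑ z : F, (({x | x ^ 3 = z} : Finset F).card : ℤ) * signTrace z := by
    rw [← Finset.sum_fiberwise Finset.univ (fun x : F => x ^ 3)]
    refine Finset.sum_congr rfl fun z _ => ?_
    rw [Finset.sum_congr rfl (g := fun _ => signTrace z), Finset.sum_const, nsmul_eq_mul]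
    intro x hx
    rw [(Finset.mem_filter.1 hx).2]
  have hzero : ({x | x ^ 3 = 0} : Finset F) = {0} := by ext; simp
  rw [h, ← Finset.add_sum_erase _ _ (Finset.mem_univ 0), hzero, Finset.card_singleton,
    signTrace_zero]
  have hdvd : (3 : ℤ) ∣ ∑ z ∈ Finset.univ.erase (0 : F),
      (({x | x ^ 3 = z} : Finset F).card : ℤ) * signTrace z :=
    Finset.dvd_sum fun z hz => Dvd.dvd.mul_right
      (by exact_mod_cast three_dvd_card_cube_fiber hω (Finset.ne_of_mem_erase hz)) _
  simpa using (Int.modEq_zero_iff_dvd.2 hdvd).add_left 1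

theorem exists_sq_add_self_eq_one (h : 3 ∣ Fintype.card F - 1) : ∃ ω : F, ω ^ 2 + ω = 1 := by
  have : Fact (Nat.Prime 3) := ⟨Nat.prime_three⟩
  obtain ⟨u, hu⟩ := exists_prime_orderOf_dvd_card (G := Fˣ) 3 (by rwa [Fintype.card_units])
  have h2 : (2 : F) = 0 := CharTwo.two_eq_zero
  have hu3 : (u : F) ^ 3 = 1 := by
    rw [← Units.val_pow_eq_pow_val, ← hu, pow_orderOf_eq_one, Units.val_one]
  have hu1 : (u : F) - 1 ≠ 0 := by
    rw [sub_ne_zero]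
    intro h1
    rw [Units.val_eq_one.1 h1, orderOf_one] at hu
    omega
  refine ⟨u, mul_left_cancel₀ hu1 ?_⟩
  linear_combination hu3 + (1 - (u : F)) * h2

theorem sum_signTrace_cube {n : ℕ} (hn : Odd n) (hcard : Fintype.card F = 4 ^ n) :
    ∑ x : F, signTrace (x ^ 3) = 2 * 2 ^ n := by
  obtain ⟨ω, hω⟩ := exists_sq_add_self_eq_one (F := F) (by
    rw [hcard]
    simpa using Nat.sub_dvd_pow_sub_pow 4 1 n)
  have hmod := sum_signTrace_cube_modEq hω
  have hsq := sq_sum_signTrace_cube hω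
  have h4 : (4 : ℤ) ^ n = (2 ^ n) ^ 2 := by rw [← pow_mul, mul_comm, pow_mul]; norm_num
  have hsq' : (∑ x : F, signTrace (x ^ 3)) ^ 2 = (2 * 2 ^ n) ^ 2 := by
    rw [hsq, hcard]
    push_cast
    rw [h4]
    ring
  have h2 : (2 : ℤ) ^ n ≡ -1 [ZMOD 3] := by
    simpa [hn.neg_one_pow] using (show (2 : ℤ) ≡ -1 [ZMOD 3] by decide).pow n
  rcases sq_eq_sq_iff_eq_or_eq_neg.1 hsq' with h | h
  · exact h
  · rw [h] at hmod
    have := (h2.mul_left 2).neg.symm.trans hmod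
    exact absurd this (by decide)

theorem card_sq_add_self_eq_cube {n : ℕ} (hn : Odd n) (hcard : Fintype.card F = 4 ^ n) :
    Fintype.card {p : F × F // p.2 ^ 2 + p.2 = p.1 ^ 3} = 4 ^ n + 2 * 2 ^ n := by
  have h : Fintype.card {p : F × F // p.2 ^ 2 + p.2 = p.1 ^ 3} =
      ∑ x : F, ({y | y ^ 2 + y = x ^ 3} : Finset F).card := by
    simp_rw [Fintype.card_subtype, Finset.card_filter]
    exact Fintype.sum_prod_type _
  zify
  rw [h, Nat.cast_sum, Finset.sum_congr rfl fun x _ => card_artinSchreierTwo_fiber (x ^ 3),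
    Finset.sum_add_distrib, sum_signTrace_cube hn hcard]
  simp [hcard]

end ArtinSchreier

/-- Let `q = 4^(2a+1)` and let `E : y² + y = x³` over `F_q`. Then `E` is a maximal
elliptic curve: `#E(F_q) = q + 2√q + 1 = (2^(2a+1) + 1)²`. -/
theorem maximal_elliptic_curve_card (a : ℕ) :
    let q : ℕ := 4 ^ (2 * a + 1)
    let F := GaloisField 2 (2 * (2 * a + 1))
    let W : WeierstrassCurve.Affine F := { a₁ := 0, a₂ := 0, a₃ := 1, a₄ := 0, a₆ := 0 }
    Nat.card W.Point = q + 2 * 2 ^ (2 * a + 1) + 1 ∧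
    Nat.card W.Point = (2 ^ (2 * a + 1) + 1) ^ 2 := by
  intro q F W
  classical
  have : Fintype F := Fintype.ofFinite F
  have h4 : 4 ^ (2 * a + 1) = 2 ^ (2 * (2 * a + 1)) := by rw [pow_mul]; norm_num
  have hcard : Fintype.card F = 4 ^ (2 * a + 1) := by
    rw [← Nat.card_eq_fintype_card, GaloisField.card 2 _ (by omega), h4]
  have h2 : (2 : F) = 0 := CharTwo.two_eq_zero
  have hΔ : W.Δ = 1 := by
    simp only [WeierstrassCurve.Δ, WeierstrassCurve.b₂, WeierstrassCurve.b₄,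
      WeierstrassCurve.b₆, WeierstrassCurve.b₈, W]
    linear_combination (-14) * h2
  have : W.IsElliptic := ⟨by rw [hΔ]; exact isUnit_one⟩
  have hpoint : Nat.card W.Point = q + 2 * 2 ^ (2 * a + 1) + 1 := by
    rw [Nat.card_congr W.pointEquiv]
    have e : {xy : F × F // W.Equation xy.1 xy.2} ≃ {p : F × F // p.2 ^ 2 + p.2 = p.1 ^ 3} :=
      Equiv.subtypeEquivRight fun p => by
        rw [WeierstrassCurve.Affine.equation_iff]
        simp [W]
    rw [Nat.card_congr (show WithZero _ ≃ Option _ from e.optionCongr), Nat.card_eq_fintype_card,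
      Fintype.card_option, card_sq_add_self_eq_cube ⟨a, rfl⟩ hcard]
  refine ⟨hpoint, hpoint.trans ?_⟩
  simp only [q]
  rw [h4, mul_comm 2 (2 * a + 1), pow_mul]
  ring
end
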